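/- arXiv:1610.04498 — 2 statements merged into one kernel-verified Lean document; each statement's English description precedes it below -/
import Mathlib

section
/- (Lemma 1) For every selection vector s ∈ 𝒮 and every ordering vector π ∈ Π(s), the vertical ordering vector minimizes the min-cut value: c_min(s, π_v(s)) ≤ c_min(s, π). -/
open Finset

/-- Number of earlier occurrences of the same cluster: `#{ j < i : π j = π i }`. -/
def repCount {L k : ℕ} (π : Fin k → Fin L) (i : Fin k) : ℕ :=
  (Finset.univ.filter fun j => j < i ∧ π j = π i).card

/-- `a_i(π) = n_I − 1 − #{ j < i : π j = π i }`. -/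
def aSeq (nI : ℕ) {L k : ℕ} (π : Fin k → Fin L) (i : Fin k) : ℤ :=
  (nI : ℤ) - 1 - (repCount π i : ℤ)

/-- The `i`-th weight value `ω_i(π) = a_i(π) β_I + (n − i − a_i(π)) β_c`
(here `i : Fin k` represents the 1-indexed position `i+1`). -/
def wSeq (n nI : ℕ) (βI βc : ℝ) {L k : ℕ} (π : Fin k → Fin L) (i : Fin k) : ℝ :=
  (aSeq nI π i : ℝ) * βI + ((n : ℝ) - ((i : ℕ) + 1) - (aSeq nI π i : ℝ)) * βc

/-- Min-cut value `c_min(s, π) = Σ_{i=1}^k min(ω_i(π), α)`. -/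
def cminVal (n nI : ℕ) (βI βc α : ℝ) {L k : ℕ} (π : Fin k → Fin L) : ℝ :=
  ∑ i, min (wSeq n nI βI βc π i) α

/-- `s` is a selection vector: entries bounded by `n_I`, nonincreasing, summing to `k`. -/
def IsSelection (nI k : ℕ) {L : ℕ} (s : Fin L → ℕ) : Prop :=
  (∀ i, s i ≤ nI) ∧ (∀ i j : Fin L, i ≤ j → s j ≤ s i) ∧ ∑ i, s i = k

/-- `π` is an ordering vector for `s`: for each cluster `l`, exactly `s l` entries equal `l`. -/
def IsOrdering {L k : ℕ} (s : Fin L → ℕ) (π : Fin k → Fin L) : Prop :=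
  ∀ l, (Finset.univ.filter fun i => π i = l).card = s l

/-- The vertical ordering vector `π_v(s)`: concatenation over rounds `r = 0, 1, …` of the
clusters `l` with `s l > r`, listed in increasing order (Algorithm 1). -/
def verticalOrdering {L : ℕ} (hL : 0 < L) (k : ℕ) (s : Fin L → ℕ) : Fin k → Fin L :=
  fun i =>
    ((List.range k).flatMap fun r => (List.finRange L).filter fun l => r < s l).getD i.1 ⟨0, hL⟩

/-- The horizontal selection vector `s_h` (0-indexed clusters). -/
def horizontalSel (L nI k : ℕ) : Fin L → ℕ :=
  fun i => if (i : ℕ) < k / nI then nI else if (i : ℕ) = k / nI then k % nI else 0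

/-- The pairs `(r, l)` with `r < s l` and `r < k`, listed in lexicographic order. -/
def verticalPairs {L : ℕ} (k : ℕ) (s : Fin L → ℕ) : List (ℕ × Fin L) :=
  (List.range k).flatMap fun r =>
    ((List.finRange L).filter fun l => r < s l).map fun l => (r, l)

lemma mem_verticalPairs {L k : ℕ} {s : Fin L → ℕ} {p : ℕ × Fin L} :
    p ∈ verticalPairs k s ↔ p.1 < k ∧ p.1 < s p.2 := by
  obtain ⟨r, l⟩ := p
  simp [verticalPairs]

lemma map_snd_verticalPairs {L k : ℕ} (s : Fin L → ℕ) :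
    (verticalPairs k s).map Prod.snd =
      (List.range k).flatMap fun r => (List.finRange L).filter fun l => r < s l := by
  simp [verticalPairs, List.map_flatMap, Function.comp_def]

lemma pairwise_verticalPairs {L k : ℕ} (s : Fin L → ℕ) :
    (verticalPairs k s).Pairwise fun p q => p.1 < q.1 ∨ p.1 = q.1 ∧ p.2 < q.2 := by
  rw [verticalPairs, List.pairwise_flatMap]
  refine ⟨fun r _ => ?_, ?_⟩
  · rw [List.pairwise_map]
    exact ((List.pairwise_lt_finRange L).filter _).imp fun h => Or.inr ⟨rfl, h⟩
  · refine List.pairwise_lt_range.imp fun {a b} hab x hx y hy => Or.inl ?_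
    simp only [List.mem_map] at hx hy
    obtain ⟨_, -, rfl⟩ := hx
    obtain ⟨_, -, rfl⟩ := hy
    exact hab

lemma length_verticalPairs {L k : ℕ} {s : Fin L → ℕ} (hs : ∑ l, s l = k) :
    (verticalPairs k s).length = k := by
  have hnd : (verticalPairs k s).Nodup :=
    (pairwise_verticalPairs s).imp fun {p q} h hpq => by
      subst hpq
      simp at h
  have hset : (verticalPairs k s).toFinset =
      (Finset.range k ×ˢ Finset.univ).filter fun p => p.1 < s p.2 := by
    ext p
    simp [mem_verticalPairs]
  rw [← List.toFinset_card_of_nodup hnd, hset, Finset.card_filter, Finset.sum_product_right]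
  conv_rhs => rw [← hs]
  refine Finset.sum_congr rfl fun l _ => ?_
  have hl : s l ≤ k := hs ▸ Finset.single_le_sum (fun _ _ => Nat.zero_le _) (Finset.mem_univ l)
  have : (Finset.range k).filter (fun r => r < s l) = Finset.range (s l) := by
    ext r
    simp only [Finset.mem_filter, Finset.mem_range]
    omega
  rw [← Finset.card_filter, this, Finset.card_range]

lemma repCount_lt_repCount {L k : ℕ} {π : Fin k → Fin L} {i j : Fin k}
    (hij : i < j) (h : π i = π j) : repCount π i < repCount π j := by
  refine Finset.card_lt_card (Finset.ssubset_iff_of_subset ?_ |>.2 ⟨i, ?_, ?_⟩)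
  · intro x hx
    simp only [Finset.mem_filter, Finset.mem_univ, true_and] at hx ⊢
    exact ⟨hx.1.trans hij, hx.2.trans h⟩
  · simpa using ⟨hij, h⟩
  · simp

lemma IsOrdering.repCount_lt {L k : ℕ} {s : Fin L → ℕ} {π : Fin k → Fin L}
    (hπ : IsOrdering s π) (i : Fin k) : repCount π i < s (π i) := by
  rw [← hπ (π i)]
  refine Finset.card_lt_card (Finset.ssubset_iff_of_subset ?_ |>.2 ⟨i, ?_, ?_⟩)
  · intro x hx
    simp only [Finset.mem_filter, Finset.mem_univ, true_and] at hx ⊢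
    exact hx.2
  · simp
  · simp

/-- A labelling of `Fin k` by distinct cells of a diagram with `k` cells is a bijection. -/
lemma exists_equiv_cells {L k : ℕ} {s : Fin L → ℕ} (hs : ∑ l, s l = k)
    (c : Fin k → Fin L) (r : Fin k → ℕ) (hr : ∀ i, r i < s (c i))
    (hinj : ∀ i j, c i = c j → r i = r j → i = j) :
    ∃ e : Fin k ≃ Σ l, Fin (s l), ∀ i, ((e i).2 : ℕ) = r i := by
  let f : Fin k → Σ l, Fin (s l) := fun i => ⟨c i, r i, hr i⟩
  have hf : f.Injective := fun i j hij => by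
    refine hinj i j (congrArg Sigma.fst hij) ?_
    exact congrArg (fun x : Σ l, Fin (s l) => (x.2 : ℕ)) hij
  have hb : f.Bijective := (Fintype.bijective_iff_injective_and_card f).2 ⟨hf, by simp [hs]⟩
  exact ⟨Equiv.ofBijective f hb, fun _ => rfl⟩

lemma IsOrdering.exists_equiv {L k : ℕ} {s : Fin L → ℕ} {π : Fin k → Fin L}
    (hs : ∑ l, s l = k) (hπ : IsOrdering s π) :
    ∃ e : Fin k ≃ Σ l, Fin (s l), ∀ i, ((e i).2 : ℕ) = repCount π i := by
  refine exists_equiv_cells hs π (repCount π) hπ.repCount_lt fun i j hc hr => ?_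
  rcases lt_trichotomy i j with h | h | h
  · exact absurd hr (repCount_lt_repCount h hc).ne
  · exact h
  · exact absurd hr.symm (repCount_lt_repCount h hc.symm).ne

/-- Along the vertical ordering the repetition counts increase, and they exhaust the cells. -/
lemma verticalOrdering_repCount {L : ℕ} (hL : 0 < L) {k : ℕ} {s : Fin L → ℕ}
    (hs : ∑ l, s l = k) :
    Monotone (repCount (verticalOrdering hL k s)) ∧
      ∃ e : Fin k ≃ Σ l, Fin (s l),
        ∀ i, ((e i).2 : ℕ) = repCount (verticalOrdering hL k s) i := by
  have hlen := length_verticalPairs hs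
  let q : Fin k → ℕ × Fin L := fun i => (verticalPairs k s)[(i : ℕ)]'(by omega)
  have hv : ∀ i, verticalOrdering hL k s i = (q i).2 := fun i => by
    have hi : (i : ℕ) < (verticalPairs k s).length := by omega
    simp [verticalOrdering, ← map_snd_verticalPairs, q, hi]
  have hlex : ∀ i j, i < j → (q i).1 < (q j).1 ∨ (q i).1 = (q j).1 ∧ (q i).2 < (q j).2 :=
    fun i j hij => List.pairwise_iff_getElem.1 (pairwise_verticalPairs s) i j
      (by omega) (by omega) hij
  have hinj : ∀ i j, (q i).2 = (q j).2 → (q i).1 = (q j).1 → i = j := fun i j h2 h1 => by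
    rcases lt_trichotomy i j with h | h | h
    · have := hlex i j h
      simp [h1, h2] at this
    · exact h
    · have := hlex j i h
      simp [h1, h2] at this
  have hmem : ∀ i, (q i).1 < k ∧ (q i).1 < s (q i).2 := fun i =>
    mem_verticalPairs.1 (List.getElem_mem _)
  have hrep : repCount (verticalOrdering hL k s) = fun i => (q i).1 := by
    funext i
    have himg : (Finset.univ.filter fun j => j < i ∧ (q j).2 = (q i).2).image
        (fun j => (q j).1) = Finset.range (q i).1 := by
      ext r
      simp only [Finset.mem_image, Finset.mem_filter, Finset.mem_univ, true_and,
        Finset.mem_range]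
      constructor
      · rintro ⟨j, ⟨hji, hj⟩, rfl⟩
        have := hlex j i hji
        simpa [hj] using this
      · intro hr
        have hm : (r, (q i).2) ∈ verticalPairs k s :=
          mem_verticalPairs.2 ⟨hr.trans (hmem i).1, hr.trans (hmem i).2⟩
        obtain ⟨j, hj, hjq⟩ := List.getElem_of_mem hm
        have hq : q ⟨j, by omega⟩ = (r, (q i).2) := hjq
        refine ⟨⟨j, by omega⟩, ⟨?_, by rw [hq]⟩, by rw [hq]⟩
        by_contra hlt
        rcases (not_lt.1 hlt).eq_or_lt with h | h
        · rw [← h] at hq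
          have := congrArg Prod.fst hq
          simp only at this
          omega
        · have := hlex _ _ h
          rw [hq] at this
          simp only [lt_self_iff_false, and_false, or_false] at this
          omega
    simp only [repCount, hv]
    rw [← Finset.card_range (q i).1, ← himg, Finset.card_image_of_injOn]
    intro a ha b hb hab
    simp only [Finset.coe_filter, Finset.mem_univ, true_and, Set.mem_ofPred_eq] at ha hb
    exact hinj a b (ha.2.trans hb.2.symm) hab
  rw [hrep]
  refine ⟨fun i j hij => ?_, exists_equiv_cells hs _ _ (fun i => (hmem i).2) hinj⟩
  rcases hij.eq_or_lt with rfl | h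
  · exact le_rfl
  · rcases hlex i j h with h | h
    exacts [h.le, h.1.le]

lemma min_add_min_sub_le {w x y α : ℝ} (hx : 0 ≤ x) (hy : 0 ≤ y) :
    min w α + min (w - x - y) α ≤ min (w - x) α + min (w - y) α := by
  rcases min_cases w α with h₁ | h₁ <;> rcases min_cases (w - x - y) α with h₂ | h₂ <;>
    rcases min_cases (w - x) α with h₃ | h₃ <;> rcases min_cases (w - y) α with h₄ | h₄ <;>
    linarith

/-- Rearrangement inequality: sorting minimizes the sum of a submodular function. -/
lemma sum_comp_sort_le {k : ℕ} (F : Fin k → ℕ → ℝ)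
    (hF : ∀ i j a b, i < j → a < b → F i a + F j b ≤ F i b + F j a) (f : Fin k → ℕ) :
    ∑ i, F i ((f ∘ Tuple.sort f) i) ≤ ∑ i, F i (f i) := by
  refine Tuple.bubble_sort_induction (P := fun g => ∑ i, F i (g i) ≤ ∑ i, F i (f i)) le_rfl
    fun g i j hij hg hle => le_trans ?_ hle
  have hj : j ∈ Finset.univ.erase i := by simp [hij.ne']
  rw [← Finset.add_sum_erase _ _ (Finset.mem_univ i), ← Finset.add_sum_erase _ _ hj,
    ← Finset.add_sum_erase _ (fun x => F x (g x)) (Finset.mem_univ i),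
    ← Finset.add_sum_erase _ (fun x => F x (g x)) hj]
  have hrest : ∑ x ∈ (Finset.univ.erase i).erase j, F x ((g ∘ Equiv.swap i j) x) =
      ∑ x ∈ (Finset.univ.erase i).erase j, F x (g x) := by
    refine Finset.sum_congr rfl fun x hx => ?_
    simp only [Finset.mem_erase, Finset.mem_univ, and_true] at hx
    simp [Equiv.swap_apply_of_ne_of_ne hx.2 hx.1]
  have := hF i j _ _ hij hg
  rw [hrest]
  simp only [Function.comp_apply, Equiv.swap_apply_left, Equiv.swap_apply_right]
  linarith

/-- **Lemma 1.** For every selection vector `s ∈ 𝒮` and every ordering vector `π ∈ Π(s)`, the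
vertical ordering vector minimizes the min-cut value: `c_min(s, π_v(s)) ≤ c_min(s, π)`. -/
theorem vertical_ordering_minimizes_mincut
    (n L k nI : ℕ) (hL : 1 ≤ L) (hn : n = L * nI) (hnI : 2 ≤ nI)
    (hk1 : 1 ≤ k) (hkn : k ≤ n)
    (βI βc : ℝ) (hβc : 0 ≤ βc) (hβIc : βc ≤ βI) (α : ℝ) (hα : 0 ≤ α)
    (s : Fin L → ℕ) (hs : IsSelection nI k s)
    (π : Fin k → Fin L) (hπ : IsOrdering s π) :
    cminVal n nI βI βc α (verticalOrdering hL k s) ≤ cminVal n nI βI βc α π := by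
  obtain ⟨hmono, e, he⟩ := verticalOrdering_repCount hL hs.2.2
  obtain ⟨e', he'⟩ := hπ.exists_equiv hs.2.2
  have hperm : repCount (verticalOrdering hL k s) = repCount π ∘ (e.trans e'.symm) := by
    funext i
    rw [← he, Function.comp_apply, ← he', Equiv.trans_apply, Equiv.apply_symm_apply]
  have hsort : repCount (verticalOrdering hL k s) = repCount π ∘ Tuple.sort (repCount π) := by
    rw [hperm] at hmono ⊢
    exact Tuple.comp_sort_eq_comp_iff_monotone.2 hmono
  have key := sum_comp_sort_le (fun i r => min (((nI : ℝ) - 1 - r) * βI +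
    ((n : ℝ) - ((i : ℕ) + 1) - ((nI : ℝ) - 1 - r)) * βc) α) (fun i j a b hij hab => ?_)
    (repCount π)
  · rw [← hsort] at key
    simpa [cminVal, wSeq, aSeq] using key
  · have hx : 0 ≤ ((b : ℝ) - a) * (βI - βc) :=
      mul_nonneg (sub_nonneg.2 (by exact_mod_cast hab.le)) (sub_nonneg.2 hβIc)
    have hy : 0 ≤ (((j : ℕ) : ℝ) - (i : ℕ)) * βc :=
      mul_nonneg (sub_nonneg.2 (by exact_mod_cast hij.le)) hβc
    convert min_add_min_sub_le (α := α) (w := ((nI : ℝ) - 1 - a) * βI +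
      ((n : ℝ) - ((i : ℕ) + 1) - ((nI : ℝ) - 1 - a)) * βc) hx hy using 3 <;> ring
end

section
/- (Lemma 2) For every selection vector s ∈ 𝒮, when the vertical ordering is used the horizontal selection vector minimizes the min-cut value: c_min(s_h, π_v(s_h)) ≤ c_min(s, π_v(s)). -/
open Finset

/-- The concatenation of the first `m` rounds of the vertical ordering. -/
def verticalPrefix {L : ℕ} (s : Fin L → ℕ) (m : ℕ) : List (Fin L) :=
  (List.range m).flatMap fun r => (List.finRange L).filter fun l => r < s l

/-- The number of clusters taking part in round `r`. -/
def roundSize {L : ℕ} (s : Fin L → ℕ) (r : ℕ) : ℕ :=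
  (Finset.univ.filter fun l => r < s l).card

lemma verticalPrefix_succ {L : ℕ} (s : Fin L → ℕ) (m : ℕ) :
    verticalPrefix s (m + 1) =
      verticalPrefix s m ++ (List.finRange L).filter fun l => m < s l := by
  simp [verticalPrefix, List.range_succ]

lemma length_filter_finRange {L : ℕ} (s : Fin L → ℕ) (r : ℕ) :
    ((List.finRange L).filter fun l => r < s l).length = roundSize s r := by
  rfl

lemma length_verticalPrefix {L : ℕ} (s : Fin L → ℕ) (m : ℕ) :
    (verticalPrefix s m).length = ∑ r ∈ range m, roundSize s r := by
  induction m with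
  | zero => simp [verticalPrefix]
  | succ m ih =>
    rw [verticalPrefix_succ, List.length_append, ih, length_filter_finRange, sum_range_succ]

lemma sum_roundSize {L : ℕ} (s : Fin L → ℕ) (m : ℕ) (hm : ∀ l, s l ≤ m) :
    ∑ r ∈ range m, roundSize s r = ∑ l, s l := by
  simp only [roundSize, card_filter]
  rw [sum_comm]
  refine sum_congr rfl fun l _ => ?_
  rw [← card_filter]
  have : (range m).filter (fun r => r < s l) = range (s l) := by
    ext r
    have := hm l
    simp only [mem_filter, mem_range]
    omega
  rw [this, card_range]

lemma count_verticalPrefix {L : ℕ} (s : Fin L → ℕ) (m : ℕ) (a : Fin L) :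
    (verticalPrefix s m).count a = min m (s a) := by
  induction m with
  | zero => simp [verticalPrefix]
  | succ m ih =>
    rw [verticalPrefix_succ, List.count_append, ih]
    by_cases h : m < s a
    · rw [List.count_eq_one_of_mem ((List.nodup_finRange L).filter _) (by simp [h])]
      omega
    · rw [List.count_eq_zero_of_not_mem (by simp [h])]
      omega

lemma exists_verticalPrefix_eq_append {L : ℕ} (s : Fin L → ℕ) {m k : ℕ} (h : m ≤ k) :
    ∃ t, verticalPrefix s k = verticalPrefix s m ++ t := by
  induction k, h using Nat.le_induction with
  | base => exact ⟨[], by simp⟩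
  | succ k _ ih =>
    obtain ⟨t, ht⟩ := ih
    exact ⟨t ++ _, by rw [verticalPrefix_succ, ht, List.append_assoc]⟩

lemma card_filter_getD_eq_count_take {α : Type*} [DecidableEq α] (l : List α) (d a : α) (i : ℕ)
    (hi : i ≤ l.length) :
    ((range i).filter fun j => l.getD j d = a).card = (l.take i).count a := by
  induction i with
  | zero => simp
  | succ i ih =>
    have hi' : i < l.length := hi
    rw [range_add_one, filter_insert, List.take_succ_eq_append_getElem hi', List.count_append,
      ← ih hi'.le, List.getD_eq_getElem _ _ hi']
    by_cases h : l[i] = a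
    · simp [h]
    · simp [h]

lemma repCount_eq_card_range {L k : ℕ} (f : ℕ → Fin L) (i : Fin k) :
    repCount (fun j : Fin k => f j) i = ((range i).filter fun j => f j = f i).card := by
  unfold repCount
  refine card_bij (fun j _ => j.1) ?_ (fun _ _ _ _ h => Fin.ext h) ?_
  · intro j hj
    simpa using hj
  · intro j hj
    rw [mem_filter, mem_range] at hj
    exact ⟨⟨j, hj.1.trans i.2⟩, mem_filter.2 ⟨mem_univ _, hj⟩, rfl⟩

/-- In the vertical ordering, an entry of round `r` has exactly `r` earlier occurrences. -/
lemma exists_round {L k : ℕ} (hL : 0 < L) (s : Fin L → ℕ) (hs : ∑ l, s l = k) (i : Fin k) :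
    repCount (verticalOrdering hL k s) i < s (verticalOrdering hL k s i) ∧
    ∑ r ∈ range (repCount (verticalOrdering hL k s) i), roundSize s r ≤ i ∧
    (i : ℕ) < ∑ r ∈ range (repCount (verticalOrdering hL k s) i + 1), roundSize s r := by
  have hle : ∀ l, s l ≤ k := fun l => hs ▸ single_le_sum (fun _ _ => Nat.zero_le _) (mem_univ l)
  have hlen : (verticalPrefix s k).length = k := by
    rw [length_verticalPrefix, sum_roundSize s k hle, hs]
  have hex : ∃ m, (i : ℕ) < (verticalPrefix s m).length := ⟨k, hlen.symm ▸ i.2⟩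
  obtain ⟨r, hr⟩ : ∃ r, Nat.find hex = r + 1 := by
    refine Nat.exists_eq_succ_of_ne_zero fun h0 => ?_
    have := Nat.find_spec hex
    rw [h0] at this
    simp [verticalPrefix] at this
  have hlt : (i : ℕ) < (verticalPrefix s (r + 1)).length := hr ▸ Nat.find_spec hex
  have hge : (verticalPrefix s r).length ≤ i :=
    not_lt.1 (Nat.find_min hex (by omega))
  have hrk : r + 1 ≤ k := hr ▸ Nat.find_min' hex (hlen.symm ▸ i.2)
  obtain ⟨t, ht⟩ := exists_verticalPrefix_eq_append s hrk
  set R := (List.finRange L).filter fun l => r < s l with hR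
  have hj : (i : ℕ) - (verticalPrefix s r).length < R.length := by
    rw [verticalPrefix_succ, List.length_append, ← hR] at hlt
    omega
  have hval : verticalOrdering hL k s i = R[(i : ℕ) - (verticalPrefix s r).length] := by
    change (verticalPrefix s k).getD i ⟨0, hL⟩ = _
    rw [ht, List.getD_append _ _ _ _ hlt, verticalPrefix_succ,
      List.getD_append_right _ _ _ _ hge, List.getD_eq_getElem _ _ hj]
  have hmem : r < s (verticalOrdering hL k s i) := by
    have : verticalOrdering hL k s i ∈ R := hval ▸ List.getElem_mem hj
    simpa [hR] using this
  have htake : (verticalPrefix s k).take i =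
      verticalPrefix s r ++ R.take (i - (verticalPrefix s r).length) := by
    rw [ht, List.take_append_of_le_length hlt.le, verticalPrefix_succ, List.take_append,
      List.take_of_length_le hge]
  have hnot : verticalOrdering hL k s i ∉ R.take (i - (verticalPrefix s r).length) := by
    rw [hval]
    intro hm
    obtain ⟨p, hp, hpe⟩ := List.mem_take_iff_getElem.1 hm
    have hnd : R.Nodup := (List.nodup_finRange L).filter _
    have := (hnd.getElem_inj_iff).1 hpe
    omega
  have hrep : repCount (verticalOrdering hL k s) i = r := by
    have h1 := repCount_eq_card_range (fun j => (verticalPrefix s k).getD j ⟨0, hL⟩) i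
    rw [card_filter_getD_eq_count_take _ _ _ _ (hlen.symm ▸ i.2.le), htake, List.count_append,
      count_verticalPrefix] at h1
    have h2 : repCount (verticalOrdering hL k s) i =
      min r (s (verticalOrdering hL k s i)) + (R.take _).count (verticalOrdering hL k s i) := h1
    rw [h2, List.count_eq_zero_of_not_mem hnot]
    omega
  rw [hrep, ← length_verticalPrefix, ← length_verticalPrefix]
  exact ⟨hmem, hge, hlt⟩

lemma roundSize_antitone {L : ℕ} (s : Fin L → ℕ) : Antitone (roundSize s) := fun _ _ h =>
  card_le_card fun _ hl => mem_filter.2 ⟨mem_univ _, h.trans_lt (mem_filter.1 hl).2⟩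

lemma sum_horizontalSel {L nI k : ℕ} (hnI : 0 < nI) (hk : k ≤ L * nI) :
    ∑ l, horizontalSel L nI k l = k := by
  have hdm := Nat.div_add_mod k nI
  have key : ∀ N, ∑ i ∈ range N,
      (if i < k / nI then nI else if i = k / nI then k % nI else 0) =
      if N ≤ k / nI then N * nI else k := by
    intro N
    induction N with
    | zero => simp
    | succ N ih =>
      rw [sum_range_succ, ih]
      rcases lt_trichotomy N (k / nI) with h | h | h
      · rw [if_pos h.le, if_pos h, if_pos (Nat.succ_le_of_lt h)]
        ring
      · rw [if_pos h.le, if_neg (by omega), if_pos h, if_neg (by omega), h, mul_comm, hdm]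
      · rw [if_neg (by omega), if_neg (by omega), if_neg (by omega), if_neg (by omega), add_zero]
  have hsum := Fin.sum_univ_eq_sum_range
    (fun i => if i < k / nI then nI else if i = k / nI then k % nI else 0) L
  refine hsum.trans ((key L).trans ?_)
  split_ifs with h
  · exact le_antisymm ((Nat.le_div_iff_mul_le hnI).1 h) hk
  · rfl

lemma horizontalSel_le {L nI k : ℕ} (hnI : 0 < nI) (l : Fin L) : horizontalSel L nI k l ≤ nI := by
  have := Nat.mod_lt k hnI
  unfold horizontalSel
  split_ifs <;> omega

lemma roundSize_horizontalSel_le (L nI k r : ℕ) :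
    roundSize (horizontalSel L nI k) r ≤ k / nI + if r < k % nI then 1 else 0 := by
  rw [← card_range (k / nI + if r < k % nI then 1 else 0)]
  refine card_le_card_of_injOn (fun l : Fin L => (l : ℕ)) ?_ (Fin.val_injective.injOn)
  intro l hl
  have hl := (mem_filter.1 hl).2
  simp only [horizontalSel] at hl
  simp only [coe_range, Set.mem_Iio]
  split_ifs at hl ⊢ <;> omega

lemma sum_roundSize_horizontalSel_le (L nI k m : ℕ) :
    ∑ r ∈ range m, roundSize (horizontalSel L nI k) r ≤ m * (k / nI) + min m (k % nI) := by
  induction m with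
  | zero => simp
  | succ m ih =>
    have h := roundSize_horizontalSel_le L nI k m
    rw [sum_range_succ, Nat.succ_mul]
    split_ifs at h <;> omega

/-- A nonincreasing sequence dominates the balanced one in its partial sums. -/
lemma le_sum_range_of_antitone {h : ℕ → ℕ} (hh : Antitone h) {N m : ℕ} (hm : m ≤ N) {k : ℕ}
    (hk : ∑ r ∈ range N, h r = k) :
    m * (k / N) + min m (k % N) ≤ ∑ r ∈ range m, h r := by
  by_cases hq : k / N + 1 ≤ h m
  · have h1 : ∑ _r ∈ range m, (k / N + 1) ≤ ∑ r ∈ range m, h r :=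
      sum_le_sum fun r hr => hq.trans (hh (mem_range.1 hr).le)
    rw [sum_const, card_range, smul_eq_mul, mul_add, mul_one] at h1
    omega
  · have h1 : ∑ r ∈ Ico m N, h r ≤ ∑ _r ∈ Ico m N, k / N :=
      sum_le_sum fun r hr => (hh (mem_Ico.1 hr).1).trans (by omega)
    rw [sum_const, Nat.card_Ico, smul_eq_mul, Nat.sub_mul] at h1
    have h2 := sum_range_add_sum_Ico h hm
    have h3 := Nat.div_add_mod k N
    have h4 := Nat.mul_le_mul_right (k / N) hm
    omega

lemma repCount_verticalOrdering_le {L nI k : ℕ} (hL : 0 < L) (hnI : 0 < nI) (hk : k ≤ L * nI)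
    (s : Fin L → ℕ) (hle : ∀ l, s l ≤ nI) (hs : ∑ l, s l = k) (i : Fin k) :
    repCount (verticalOrdering hL k s) i ≤
      repCount (verticalOrdering hL k (horizontalSel L nI k)) i := by
  obtain ⟨-, h1, -⟩ := exists_round hL s hs i
  obtain ⟨h2, -, h3⟩ := exists_round hL (horizontalSel L nI k) (sum_horizontalSel hnI hk) i
  by_contra! hlt
  have h4 := le_sum_range_of_antitone (roundSize_antitone s)
    (Nat.succ_le_of_lt (h2.trans_le (horizontalSel_le hnI _)))
    ((sum_roundSize s nI hle).trans hs)
  have h5 := (h3.trans_le (sum_roundSize_horizontalSel_le _ _ _ _)).trans_le h4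
  have h6 := sum_le_sum_of_subset (f := roundSize s) (range_mono (Nat.succ_le_of_lt hlt))
  exact absurd (h5.trans_le (h6.trans h1)) (lt_irrefl _)

lemma wSeq_le_of_repCount_le (n nI : ℕ) {βI βc : ℝ} (hβ : βc ≤ βI) {L k : ℕ}
    {π π' : Fin k → Fin L} {i : Fin k} (h : repCount π' i ≤ repCount π i) :
    wSeq n nI βI βc π i ≤ wSeq n nI βI βc π' i := by
  have h' : (repCount π' i : ℝ) ≤ repCount π i := by exact_mod_cast h
  simp only [wSeq, aSeq]
  push_cast
  nlinarith [mul_nonneg (sub_nonneg.2 h') (sub_nonneg.2 hβ)]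

/-- **Lemma 2.** For every selection vector `s ∈ 𝒮`, when the vertical ordering is used the
horizontal selection vector minimizes the min-cut value:
`c_min(s_h, π_v(s_h)) ≤ c_min(s, π_v(s))`. -/
theorem horizontal_selection_minimizes_mincut
    (n L k nI : ℕ) (hL : 1 ≤ L) (hn : n = L * nI) (hnI : 2 ≤ nI)
    (hk1 : 1 ≤ k) (hkn : k ≤ n)
    (βI βc : ℝ) (hβc : 0 ≤ βc) (hβIc : βc ≤ βI) (α : ℝ) (hα : 0 ≤ α)
    (s : Fin L → ℕ) (hs : IsSelection nI k s) :
    cminVal n nI βI βc α (verticalOrdering hL k (horizontalSel L nI k)) ≤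
      cminVal n nI βI βc α (verticalOrdering hL k s) := by
  subst hn
  exact sum_le_sum fun i _ => min_le_min_right α <| wSeq_le_of_repCount_le _ nI hβIc <|
    repCount_verticalOrdering_le hL (by omega) hkn s hs.1 hs.2.2 i
end
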